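/- Let u be a solution of the nonlinear Landau–Zener system, v its gauge transform and σ(s) = s + m(u(s)). Let C : ℝ → L(𝓗²) be continuously differentiable and such that for every s ∈ ℝ, C(s) commutes with Λ(s) and C(s) = Π⁺(s) C(s) Π⁻(s), and set B(s) = (1/2)Λ(s)^{-1}C(s). Then the function s ↦ ⟨B(s)v(s), v(s)⟩ is differentiable and for every s ∈ ℝ: ⟨C(s)v(s), v(s)⟩ = −i·(d/ds)⟨B(s)v(s), v(s)⟩ + i·⟨B′(s)v(s), v(s)⟩. -/

import Mathlib

open ContinuousLinearMap Complex Filter Topology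
open scoped InnerProductSpace

noncomputable section

variable {H : Type*} [NormedAddCommGroup H] [InnerProductSpace ℂ H] [CompleteSpace H]

/-- Functional calculus `χ(A)` of a selfadjoint operator `A` for a complex-valued
function `χ : ℝ → ℂ` (defined via the real continuous functional calculus applied to
the real and imaginary parts of `χ`). -/
def fc (χ : ℝ → ℂ) (A : H →L[ℂ] H) : H →L[ℂ] H :=
  cfc (fun x : ℝ => (χ x).re) A + Complex.I • cfc (fun x : ℝ => (χ x).im) A

/-- The commutation assumption: for every continuous `χ : ℝ → ℂ`,
`χ(GG*)G = Gχ(G*G)` and `χ(G*G)G* = G*χ(GG*)`. -/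
def CommHyp (G : H →L[ℂ] H) : Prop :=
  ∀ χ : ℝ → ℂ, Continuous χ →
    (fc χ (G * ContinuousLinearMap.adjoint G)) ∘L G
        = G ∘L (fc χ (ContinuousLinearMap.adjoint G * G)) ∧
    (fc χ (ContinuousLinearMap.adjoint G * G)) ∘L ContinuousLinearMap.adjoint G
        = ContinuousLinearMap.adjoint G ∘L (fc χ (G * ContinuousLinearMap.adjoint G))

/-- The equivalence between `𝓗²` (with its Hilbert space structure) and `𝓗 × 𝓗`. -/
def eqv : WithLp 2 (H × H) ≃L[ℂ] H × H := WithLp.prodContinuousLinearEquiv 2 ℂ H H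

/-- The operator `V(s)(w₁,w₂) = (s·w₁ + Gw₂, G*w₁ − s·w₂)` on `𝓗²`. -/
def Vop (G : H →L[ℂ] H) (s : ℝ) : WithLp 2 (H × H) →L[ℂ] WithLp 2 (H × H) :=
  (eqv (H := H)).symm.toContinuousLinearMap ∘L
    ((((s : ℂ) • ContinuousLinearMap.fst ℂ H H + G ∘L ContinuousLinearMap.snd ℂ H H)).prod
      ((ContinuousLinearMap.adjoint G) ∘L ContinuousLinearMap.fst ℂ H H
        - (s : ℂ) • ContinuousLinearMap.snd ℂ H H)) ∘L
    (eqv (H := H)).toContinuousLinearMap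

/-- `F₁(u) = f₁(‖u₁‖², ‖u₂‖²)`. -/
def F1 (f₁ : ℝ × ℝ → ℝ) (u : WithLp 2 (H × H)) : ℝ := f₁ (‖u.fst‖ ^ 2, ‖u.snd‖ ^ 2)

/-- `F₂(u) = f₂(‖u₁‖², ‖u₂‖²)`. -/
def F2 (f₂ : ℝ × ℝ → ℝ) (u : WithLp 2 (H × H)) : ℝ := f₂ (‖u.fst‖ ^ 2, ‖u.snd‖ ^ 2)

/-- The nonlinear term `F(u)u = (F₁(u)u₁, F₂(u)u₂)`. -/
def nlt (f₁ f₂ : ℝ × ℝ → ℝ) (u : WithLp 2 (H × H)) : WithLp 2 (H × H) :=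
  (WithLp.equiv 2 (H × H)).symm ((F1 f₁ u) • u.fst, (F2 f₂ u) • u.snd)

/-- `u` is a (global, `C¹`) solution of `−i u′(s) = V(s)u(s) + δ F(u(s))u(s)`:
equivalently, `u′(s) = i (V(s)u(s) + δ F(u(s))u(s))` for all `s`. -/
def IsLZSol (G : H →L[ℂ] H) (δ : ℝ) (f₁ f₂ : ℝ × ℝ → ℝ) (u : ℝ → WithLp 2 (H × H)) : Prop :=
  ∀ s : ℝ, HasDerivAt u (Complex.I • (Vop G s (u s) + δ • nlt f₁ f₂ (u s))) s

/-- `f ∈ C²(ℝ²;ℝ)` with bounded second derivative. -/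
def C2Bdd (f : ℝ × ℝ → ℝ) : Prop :=
  ContDiff ℝ 2 f ∧ ∃ C : ℝ, ∀ p : ℝ × ℝ, ‖iteratedFDeriv ℝ 2 f p‖ ≤ C

/-- `θ ∈ C_c^∞(ℝ;ℝ)`, `0 ≤ θ ≤ 1`, `θ = 1` on `(−1/2,1/2)` and `θ = 0` outside `[−1,1]`. -/
def IsCutoff (θ : ℝ → ℝ) : Prop :=
  ContDiff ℝ (⊤ : ℕ∞) θ ∧ HasCompactSupport θ ∧ (∀ x, 0 ≤ θ x ∧ θ x ≤ 1) ∧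
    (∀ x, |x| < 1/2 → θ x = 1) ∧ (∀ x, 1 < |x| → θ x = 0)

/-- The cutoff operator `Θ_R = diag(θ(GG*/R²), θ(G*G/R²))`. -/
def Theta (G : H →L[ℂ] H) (θ : ℝ → ℝ) (R : ℝ) :
    WithLp 2 (H × H) →L[ℂ] WithLp 2 (H × H) :=
  (eqv (H := H)).symm.toContinuousLinearMap ∘L
    ((cfc (fun x : ℝ => θ (x / R ^ 2)) (G * ContinuousLinearMap.adjoint G)).prodMap
      (cfc (fun x : ℝ => θ (x / R ^ 2)) (ContinuousLinearMap.adjoint G * G))) ∘L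
    (eqv (H := H)).toContinuousLinearMap

/-- The phase `φ(s,λ) = s²/2 + (λ/2)·log|s|`. -/
def phase (s lam : ℝ) : ℝ := s ^ 2 / 2 + lam / 2 * Real.log |s|

/-- The unitary operator `e^{iφ(s,GG*)}` on `𝓗`. -/
def ePhaseP (G : H →L[ℂ] H) (s : ℝ) : H →L[ℂ] H :=
  fc (fun lam => Complex.exp (Complex.I * (phase s lam))) (G * ContinuousLinearMap.adjoint G)

/-- The unitary operator `e^{−iφ(s,G*G)}` on `𝓗`. -/
def ePhaseM (G : H →L[ℂ] H) (s : ℝ) : H →L[ℂ] H :=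
  fc (fun lam => Complex.exp (-(Complex.I * (phase s lam))))
    (ContinuousLinearMap.adjoint G * G)

/-- The model asymptotic first component `e^{iδF₁(ω)s + iϕ}·e^{iφ(s,GG*)}ω₁`. -/
def asym1 (G : H →L[ℂ] H) (δ : ℝ) (f₁ : ℝ × ℝ → ℝ) (ω : WithLp 2 (H × H)) (ϕ : ℝ)
    (s : ℝ) : H :=
  Complex.exp (Complex.I * (δ * F1 f₁ ω * s + ϕ)) • (ePhaseP G s ω.fst)

/-- The model asymptotic second component `e^{iδF₂(ω)s − iϕ}·e^{−iφ(s,G*G)}ω₂`. -/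
def asym2 (G : H →L[ℂ] H) (δ : ℝ) (f₂ : ℝ × ℝ → ℝ) (ω : WithLp 2 (H × H)) (ϕ : ℝ)
    (s : ℝ) : H :=
  Complex.exp (Complex.I * (δ * F2 f₂ ω * s - ϕ)) • (ePhaseM G s ω.snd)

/-- `α` is the incoming scattering state (at `s → −∞`) of `u`, with phase shift `ϕ`. -/
def Incoming (G : H →L[ℂ] H) (δ : ℝ) (f₁ f₂ : ℝ × ℝ → ℝ) (α : WithLp 2 (H × H)) (ϕ : ℝ)
    (u : ℝ → WithLp 2 (H × H)) : Prop :=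
  Tendsto (fun s => ‖(u s).fst - asym1 G δ f₁ α ϕ s‖ + ‖(u s).snd - asym2 G δ f₂ α ϕ s‖)
    atBot (𝓝 0)

/-- `ω` is the outgoing scattering state (at `s → +∞`) of `u`, with phase shift `ϕ`. -/
def Outgoing (G : H →L[ℂ] H) (δ : ℝ) (f₁ f₂ : ℝ × ℝ → ℝ) (ω : WithLp 2 (H × H)) (ϕ : ℝ)
    (u : ℝ → WithLp 2 (H × H)) : Prop :=
  Tendsto (fun s => ‖(u s).fst - asym1 G δ f₁ ω ϕ s‖ + ‖(u s).snd - asym2 G δ f₂ ω ϕ s‖)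
    atTop (𝓝 0)

/-- `M(u) = (δ/2)(F₁(u) + F₂(u))`. -/
def Mscal (δ : ℝ) (f₁ f₂ : ℝ × ℝ → ℝ) (u : WithLp 2 (H × H)) : ℝ :=
  δ / 2 * (F1 f₁ u + F2 f₂ u)

/-- `m(u) = (δ/2)(F₁(u) − F₂(u))`. -/
def mscal (δ : ℝ) (f₁ f₂ : ℝ × ℝ → ℝ) (u : WithLp 2 (H × H)) : ℝ :=
  δ / 2 * (F1 f₁ u - F2 f₂ u)

/-- The gauge transform `v(s) = e^{−i∫₀ˢ M(u(τ))dτ}·u(s)`. -/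
def gaugeT (δ : ℝ) (f₁ f₂ : ℝ × ℝ → ℝ) (u : ℝ → WithLp 2 (H × H)) :
    ℝ → WithLp 2 (H × H) :=
  fun s => Complex.exp (-(Complex.I * (∫ τ in (0:ℝ)..s, Mscal δ f₁ f₂ (u τ)))) • u s

/-- `σ(s) = s + m(u(s))`. -/
def sigma (δ : ℝ) (f₁ f₂ : ℝ × ℝ → ℝ) (u : ℝ → WithLp 2 (H × H)) (s : ℝ) : ℝ :=
  s + mscal δ f₁ f₂ (u s)

/-- The operator `Λ_t = diag((t² + GG*)^{1/2}, (t² + G*G)^{1/2})` on `𝓗²`. -/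
def LamOp (G : H →L[ℂ] H) (t : ℝ) : WithLp 2 (H × H) →L[ℂ] WithLp 2 (H × H) :=
  (eqv (H := H)).symm.toContinuousLinearMap ∘L
    ((cfc (fun x : ℝ => Real.sqrt (t ^ 2 + x)) (G * ContinuousLinearMap.adjoint G)).prodMap
      (cfc (fun x : ℝ => Real.sqrt (t ^ 2 + x)) (ContinuousLinearMap.adjoint G * G))) ∘L
    (eqv (H := H)).toContinuousLinearMap

/-- The operator `Λ_t⁻¹ = diag((t² + GG*)^{-1/2}, (t² + G*G)^{-1/2})` on `𝓗²`. -/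
def LamInv (G : H →L[ℂ] H) (t : ℝ) : WithLp 2 (H × H) →L[ℂ] WithLp 2 (H × H) :=
  (eqv (H := H)).symm.toContinuousLinearMap ∘L
    ((cfc (fun x : ℝ => (Real.sqrt (t ^ 2 + x))⁻¹)
        (G * ContinuousLinearMap.adjoint G)).prodMap
      (cfc (fun x : ℝ => (Real.sqrt (t ^ 2 + x))⁻¹)
        (ContinuousLinearMap.adjoint G * G))) ∘L
    (eqv (H := H)).toContinuousLinearMap

/-- The projection `Π_t^+ = (1/2)(Id + Λ_t⁻¹V(t))`. -/
def PiP (G : H →L[ℂ] H) (t : ℝ) : WithLp 2 (H × H) →L[ℂ] WithLp 2 (H × H) :=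
  (2 : ℂ)⁻¹ • (1 + LamInv G t ∘L Vop G t)

/-- The projection `Π_t^- = (1/2)(Id − Λ_t⁻¹V(t))`. -/
def PiM (G : H →L[ℂ] H) (t : ℝ) : WithLp 2 (H × H) →L[ℂ] WithLp 2 (H × H) :=
  (2 : ℂ)⁻¹ • (1 - LamInv G t ∘L Vop G t)

/-- `m̃(x,y) = (δ/2)(f₁(x,y) − f₂(x,y))`. -/
def mtilde (δ : ℝ) (f₁ f₂ : ℝ × ℝ → ℝ) : ℝ × ℝ → ℝ := fun p => δ / 2 * (f₁ p - f₂ p)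

/-- `m̲(s) = (∂₁m̃ − ∂₂m̃)(‖v₁(s)‖², ‖v₂(s)‖²)`. -/
def mbar (δ : ℝ) (f₁ f₂ : ℝ × ℝ → ℝ) (v : ℝ → WithLp 2 (H × H)) (s : ℝ) : ℝ :=
  fderiv ℝ (mtilde δ f₁ f₂) (‖(v s).fst‖ ^ 2, ‖(v s).snd‖ ^ 2) (1, 0) -
    fderiv ℝ (mtilde δ f₁ f₂) (‖(v s).fst‖ ^ 2, ‖(v s).snd‖ ^ 2) (0, 1)


/-- The operator `A(a,b,c,d)(w₁,w₂) = (a(GG*)w₁ + b(GG*)Gw₂, c(G*G)G*w₁ + d(G*G)w₂)`. -/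
def Aop (G : H →L[ℂ] H) (a b c d : ℝ → ℂ) :
    WithLp 2 (H × H) →L[ℂ] WithLp 2 (H × H) :=
  (eqv (H := H)).symm.toContinuousLinearMap ∘L
    (((fc a (G * ContinuousLinearMap.adjoint G)) ∘L ContinuousLinearMap.fst ℂ H H
        + (fc b (G * ContinuousLinearMap.adjoint G)) ∘L G ∘L ContinuousLinearMap.snd ℂ H H).prod
      ((fc c (ContinuousLinearMap.adjoint G * G)) ∘L (ContinuousLinearMap.adjoint G)
          ∘L ContinuousLinearMap.fst ℂ H H
        + (fc d (ContinuousLinearMap.adjoint G * G)) ∘L ContinuousLinearMap.snd ℂ H H)) ∘L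
    (eqv (H := H)).toContinuousLinearMap

/-- The operator `𝒦(w₁,w₂) = (−Gw₂, G*w₁)` on `𝓗²`. -/
def Kcal (G : H →L[ℂ] H) : WithLp 2 (H × H) →L[ℂ] WithLp 2 (H × H) :=
  (eqv (H := H)).symm.toContinuousLinearMap ∘L
    ((-(G ∘L ContinuousLinearMap.snd ℂ H H)).prod
      ((ContinuousLinearMap.adjoint G) ∘L ContinuousLinearMap.fst ℂ H H)) ∘L
    (eqv (H := H)).toContinuousLinearMap

/-- Differentiation of the functional calculus with respect to a real parameter. -/
theorem hasDerivAt_cfc_param {a : H →L[ℂ] H} (ha : IsSelfAdjoint a) {f f' : ℝ → ℝ → ℝ}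
    (hf : ∀ t, ContinuousOn (f t) (spectrum ℝ a))
    (hf' : Continuous fun p : ℝ × spectrum ℝ a => f' p.1 p.2)
    (hderiv : ∀ t, ∀ x ∈ spectrum ℝ a, HasDerivAt (fun t => f t x) (f' t x) t) (t : ℝ) :
    HasDerivAt (fun t => cfc (f t) a) (cfc (f' t) a) t := by
  let F : ℝ → C(spectrum ℝ a, ℝ) := fun t => ⟨_, (hf t).domRestrict⟩
  let F' : C(ℝ, C(spectrum ℝ a, ℝ)) := ContinuousMap.curry ⟨_, hf'⟩
  have hF : F = fun t => F 0 + ∫ τ in (0:ℝ)..t, F' τ := by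
    funext t
    ext x
    have h := ContinuousLinearMap.intervalIntegral_comp_comm
      (ContinuousMap.evalCLM ℝ x) (F'.continuous.intervalIntegrable 0 t (μ := MeasureTheory.volume))
    have hftc : ∫ τ in (0:ℝ)..t, f' τ x = f t x - f 0 x :=
      intervalIntegral.integral_eq_sub_of_hasDerivAt (fun τ _ => hderiv τ x x.2)
        ((hf'.comp (by fun_prop : Continuous fun τ : ℝ => (τ, x))).intervalIntegrable _ _)
    have h' : (∫ τ in (0:ℝ)..t, F' τ) x = f t x - f 0 x := h.symm.trans hftc
    simp [F, h']
  have hFd : HasDerivAt F (F' t) t := by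
    rw [hF]
    exact (intervalIntegral.integral_hasDerivAt_right (F'.continuous.intervalIntegrable _ _)
      (F'.continuous.stronglyMeasurableAtFilter _ _) F'.continuous.continuousAt).const_add _
  let Φ : C(spectrum ℝ a, ℝ) →L[ℝ] (H →L[ℂ] H) :=
    ⟨(cfcHom (R := ℝ) ha).toAlgHom.toLinearMap, cfcHom_continuous ha⟩
  have h' : cfc (f' t) a = Φ (F' t) :=
    cfc_apply (f' t) a ha (continuousOn_iff_continuous_domRestrict.2
      (hf'.comp (by fun_prop : Continuous fun x : spectrum ℝ a => (t, x))))
  have h : (fun t => cfc (f t) a) = fun t => Φ (F t) :=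
    funext fun t => cfc_apply (f t) a ha (hf t)
  rw [h, h']
  exact Φ.hasFDerivAt.comp_hasDerivAt t hFd

theorem hasDerivAt_cfc_inv_sqrt {a : H →L[ℂ] H} (ha : IsSelfAdjoint a)
    (hpos : ∀ x ∈ spectrum ℝ a, 0 < x) (t : ℝ) :
    HasDerivAt (fun t : ℝ => cfc (fun x : ℝ => (√(t ^ 2 + x))⁻¹) a)
      (cfc (fun x : ℝ => -(t / √(t ^ 2 + x)) / √(t ^ 2 + x) ^ 2) a) t := by
  refine hasDerivAt_cfc_param ha (f := fun t x => (√(t ^ 2 + x))⁻¹)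
    (f' := fun t x => -(t / √(t ^ 2 + x)) / √(t ^ 2 + x) ^ 2) (fun t => ?_) ?_ ?_ t
  · refine ContinuousOn.inv₀ (by fun_prop) fun x hx => ?_
    have := hpos x hx
    positivity
  · have h : ∀ p : ℝ × spectrum ℝ a, √(p.1 ^ 2 + p.2) ≠ 0 := fun p => by
      have := hpos p.2 p.2.2
      positivity
    have h2 : ∀ p : ℝ × spectrum ℝ a, √(p.1 ^ 2 + p.2) ^ 2 ≠ 0 := fun p => pow_ne_zero 2 (h p)
    fun_prop (disch := assumption)
  · intro t x hx
    have := hpos x hx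
    have h0 : t ^ 2 + x ≠ 0 := by positivity
    have h1 : √(t ^ 2 + x) ≠ 0 := by positivity
    have h := ((((hasDerivAt_id t).pow 2).add_const x).sqrt h0).inv h1
    refine h.congr_deriv ?_
    simp
    field_simp

theorem spectrum_mul_star_pos {G : H →L[ℂ] H} (hG : IsUnit G) :
    ∀ x ∈ spectrum ℝ (G * star G), 0 < x := by
  intro x hx
  refine lt_of_le_of_ne (spectrum_nonneg_of_nonneg (mul_star_self_nonneg G) hx) ?_
  rintro rfl
  exact spectrum.zero_notMem ℝ (hG.mul hG.star) hx

theorem spectrum_star_mul_pos {G : H →L[ℂ] H} (hG : IsUnit G) :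
    ∀ x ∈ spectrum ℝ (star G * G), 0 < x := by
  simpa using spectrum_mul_star_pos hG.star

theorem cfc_sqrt_mul_self {a : H →L[ℂ] H} (ha : IsSelfAdjoint a)
    (hpos : ∀ x ∈ spectrum ℝ a, 0 < x) (t : ℝ) :
    cfc (fun x : ℝ => √(t ^ 2 + x)) a * cfc (fun x : ℝ => √(t ^ 2 + x)) a
      = ((t : ℂ) ^ 2) • 1 + a := by
  rw [← cfc_mul _ _ a]
  have h : (spectrum ℝ a).EqOn (fun x : ℝ => √(t ^ 2 + x) * √(t ^ 2 + x))
      (fun x => t ^ 2 + id x) := fun x hx => by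
    have := hpos x hx
    exact Real.mul_self_sqrt (by positivity)
  rw [cfc_congr h, cfc_const_add (t ^ 2) id a, cfc_id ℝ a, Algebra.algebraMap_eq_smul_one]
  congr 1
  ext x
  simp [← Complex.ofReal_pow]

theorem cfc_inv_sqrt_mul_sqrt {a : H →L[ℂ] H} (ha : IsSelfAdjoint a)
    (hpos : ∀ x ∈ spectrum ℝ a, 0 < x) (t : ℝ) :
    cfc (fun x : ℝ => (√(t ^ 2 + x))⁻¹) a * cfc (fun x : ℝ => √(t ^ 2 + x)) a = 1 := by
  have h : ∀ x ∈ spectrum ℝ a, √(t ^ 2 + x) ≠ 0 := fun x hx => by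
    have := hpos x hx
    positivity
  rw [← cfc_mul (fun x => (√(t ^ 2 + x))⁻¹) _ a (ContinuousOn.inv₀ (by fun_prop) h), ← cfc_one ℝ a]
  exact cfc_congr fun x hx => inv_mul_cancel₀ (h x hx)

theorem cfc_sqrt_mul_inv_sqrt {a : H →L[ℂ] H} (ha : IsSelfAdjoint a)
    (hpos : ∀ x ∈ spectrum ℝ a, 0 < x) (t : ℝ) :
    cfc (fun x : ℝ => √(t ^ 2 + x)) a * cfc (fun x : ℝ => (√(t ^ 2 + x))⁻¹) a = 1 :=
  (cfc_commute_cfc _ _ a).eq.trans (cfc_inv_sqrt_mul_sqrt ha hpos t)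

theorem fc_ofReal (χ : ℝ → ℝ) (a : H →L[ℂ] H) : fc (fun x => (χ x : ℂ)) a = cfc χ a := by
  simp [fc]

theorem prodL2_ext {E F : Type*} {x y : WithLp 2 (E × F)}
    (h₁ : x.fst = y.fst) (h₂ : x.snd = y.snd) : x = y :=
  (WithLp.ofLp_injective 2) (Prod.ext h₁ h₂)

theorem Vop_fst (G : H →L[ℂ] H) (t : ℝ) (x : WithLp 2 (H × H)) :
    (Vop G t x).fst = (t : ℂ) • x.fst + G x.snd := rfl

theorem Vop_snd (G : H →L[ℂ] H) (t : ℝ) (x : WithLp 2 (H × H)) :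
    (Vop G t x).snd = adjoint G x.fst - (t : ℂ) • x.snd := rfl

theorem LamOp_fst (G : H →L[ℂ] H) (t : ℝ) (x : WithLp 2 (H × H)) :
    (LamOp G t x).fst = cfc (fun x : ℝ => √(t ^ 2 + x)) (G * adjoint G) x.fst := rfl

theorem LamOp_snd (G : H →L[ℂ] H) (t : ℝ) (x : WithLp 2 (H × H)) :
    (LamOp G t x).snd = cfc (fun x : ℝ => √(t ^ 2 + x)) (adjoint G * G) x.snd := rfl

theorem LamInv_fst (G : H →L[ℂ] H) (t : ℝ) (x : WithLp 2 (H × H)) :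
    (LamInv G t x).fst = cfc (fun x : ℝ => (√(t ^ 2 + x))⁻¹) (G * adjoint G) x.fst := rfl

theorem LamInv_snd (G : H →L[ℂ] H) (t : ℝ) (x : WithLp 2 (H × H)) :
    (LamInv G t x).snd = cfc (fun x : ℝ => (√(t ^ 2 + x))⁻¹) (adjoint G * G) x.snd := rfl

theorem LamOp_mul_self {G : H →L[ℂ] H} (hG : IsUnit G) (t : ℝ) :
    LamOp G t * LamOp G t = Vop G t * Vop G t := by
  have h1 := cfc_sqrt_mul_self (IsSelfAdjoint.mul_star_self G) (spectrum_mul_star_pos hG) t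
  have h2 := cfc_sqrt_mul_self (IsSelfAdjoint.star_mul_self G) (spectrum_star_mul_pos hG) t
  refine ContinuousLinearMap.ext fun x => prodL2_ext ?_ ?_
  · refine (DFunLike.congr_fun h1 x.fst).trans ?_
    simp only [mul_apply_eq_comp, Vop_fst, Vop_snd, map_sub, map_smul, add_apply, smul_apply,
      one_apply_eq_self, star_eq_adjoint]
    module
  · refine (DFunLike.congr_fun h2 x.snd).trans ?_
    simp only [mul_apply_eq_comp, Vop_fst, Vop_snd, map_add, map_smul, add_apply, smul_apply,
      one_apply_eq_self, star_eq_adjoint]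
    module

theorem LamInv_mul_LamOp {G : H →L[ℂ] H} (hG : IsUnit G) (t : ℝ) :
    LamInv G t * LamOp G t = 1 := by
  have h1 := cfc_inv_sqrt_mul_sqrt (IsSelfAdjoint.mul_star_self G) (spectrum_mul_star_pos hG) t
  have h2 := cfc_inv_sqrt_mul_sqrt (IsSelfAdjoint.star_mul_self G) (spectrum_star_mul_pos hG) t
  exact ContinuousLinearMap.ext fun x =>
    prodL2_ext (DFunLike.congr_fun h1 x.fst) (DFunLike.congr_fun h2 x.snd)

theorem LamOp_mul_LamInv {G : H →L[ℂ] H} (hG : IsUnit G) (t : ℝ) :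
    LamOp G t * LamInv G t = 1 := by
  have h1 := cfc_sqrt_mul_inv_sqrt (IsSelfAdjoint.mul_star_self G) (spectrum_mul_star_pos hG) t
  have h2 := cfc_sqrt_mul_inv_sqrt (IsSelfAdjoint.star_mul_self G) (spectrum_star_mul_pos hG) t
  exact ContinuousLinearMap.ext fun x =>
    prodL2_ext (DFunLike.congr_fun h1 x.fst) (DFunLike.congr_fun h2 x.snd)

theorem Vop_mul_LamOp {G : H →L[ℂ] H} (hG : CommHyp G) (t : ℝ) :
    Vop G t * LamOp G t = LamOp G t * Vop G t := by
  obtain ⟨h1, h2⟩ := hG (fun x => ((√(t ^ 2 + x) : ℝ) : ℂ)) (by fun_prop)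
  simp only [fc_ofReal (fun x => √(t ^ 2 + x))] at h1 h2
  refine ContinuousLinearMap.ext fun x => prodL2_ext ?_ ?_
  · have h := DFunLike.congr_fun h1 x.snd
    simp only [comp_apply] at h
    simp only [mul_apply_eq_comp, Vop_fst, LamOp_fst, LamOp_snd, map_add, map_smul, h]
  · have h := DFunLike.congr_fun h2 x.fst
    simp only [comp_apply] at h
    simp only [mul_apply_eq_comp, Vop_snd, LamOp_fst, LamOp_snd, map_sub, map_smul, h]

/-- An off-diagonal element with respect to the spectral projections of `V` is a commutator
with `V`. -/
theorem commutator_eq_of_offdiagonal {R : Type*} [Ring R] [Algebra ℂ R] {L N V C : R}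
    (hNL : N * L = 1) (hLN : L * N = 1) (hVL : V * L = L * V) (hsq : L * L = V * V)
    (hCL : C * L = L * C)
    (hoff : C = ((2 : ℂ)⁻¹ • (1 + N * V)) * (C * ((2 : ℂ)⁻¹ • (1 - N * V)))) :
    V * ((2 : ℂ)⁻¹ • (N * C)) - ((2 : ℂ)⁻¹ • (N * C)) * V = C := by
  have hNV : N * V = V * N := by
    calc N * V = N * V * (L * N) := by rw [hLN, mul_one]
      _ = N * (V * L) * N := by noncomm_ring
      _ = (N * L) * V * N := by rw [hVL]; noncomm_ring
      _ = V * N := by rw [hNL, one_mul]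
  have hJ : (N * V) * (N * V) = 1 := by
    calc (N * V) * (N * V) = N * (V * N) * V := by noncomm_ring
      _ = N * N * (V * V) := by rw [← hNV]; noncomm_ring
      _ = N * (N * L) * L := by rw [← hsq]; noncomm_ring
      _ = 1 := by rw [hNL, mul_one, hNL]
  have hleft : N * V * C = C := by
    have h : N * V * ((2 : ℂ)⁻¹ • (1 + N * V)) = (2 : ℂ)⁻¹ • (1 + N * V) := by
      rw [mul_smul_comm, mul_add, mul_one, hJ, add_comm]
    rw [hoff, ← mul_assoc, h]
  have hright : C * (N * V) = -C := by
    have h : ((2 : ℂ)⁻¹ • (1 - N * V)) * (N * V) = -((2 : ℂ)⁻¹ • (1 - N * V)) := by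
      rw [smul_mul_assoc, sub_mul, one_mul, hJ, ← smul_neg, neg_sub]
    rw [hoff, mul_assoc, mul_assoc, h, mul_neg, mul_neg]
  have hNC : N * C = C * N := by
    calc N * C = N * (C * L) * N := by rw [mul_assoc, mul_assoc, hLN, mul_one]
      _ = (N * L) * C * N := by rw [hCL]; noncomm_ring
      _ = C * N := by rw [hNL, one_mul]
  rw [mul_smul_comm, smul_mul_assoc, ← mul_assoc, ← hNV, hleft, hNC, mul_assoc, hright,
    smul_neg, sub_neg_eq_add, ← add_smul]
  norm_num

theorem Vop_symmetric (G : H →L[ℂ] H) (t : ℝ) (x y : WithLp 2 (H × H)) :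
    ⟪Vop G t x, y⟫_ℂ = ⟪x, Vop G t y⟫_ℂ := by
  simp only [WithLp.prod_inner_apply]
  change ⟪(Vop G t x).fst, y.fst⟫_ℂ + ⟪(Vop G t x).snd, y.snd⟫_ℂ
    = ⟪x.fst, (Vop G t y).fst⟫_ℂ + ⟪x.snd, (Vop G t y).snd⟫_ℂ
  simp only [Vop_fst, Vop_snd, inner_add_left, inner_add_right, inner_sub_left,
    inner_sub_right, inner_smul_left, inner_smul_right, adjoint_inner_left,
    adjoint_inner_right, Complex.conj_ofReal]
  ring

/-- Left and right composition with fixed operators, as a continuous linear map. -/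
def compSandwich {E F : Type*} [NormedAddCommGroup E] [NormedSpace ℂ E]
    [NormedAddCommGroup F] [NormedSpace ℂ F] (J : E →L[ℂ] F) (P : F →L[ℂ] E) :
    (E →L[ℂ] E) →L[ℂ] (F →L[ℂ] F) :=
  (compL ℂ F E F J) ∘L ((compL ℂ F E E).flip P)

theorem compSandwich_apply {E F : Type*} [NormedAddCommGroup E] [NormedSpace ℂ E]
    [NormedAddCommGroup F] [NormedSpace ℂ F] (J : E →L[ℂ] F) (P : F →L[ℂ] E)
    (a : E →L[ℂ] E) (x : F) : compSandwich J P a x = J (a (P x)) := rfl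

theorem LamInv_eq_compSandwich (G : H →L[ℂ] H) (t : ℝ) :
    LamInv G t =
      compSandwich ((eqv (H := H)).symm.toContinuousLinearMap ∘L inl ℂ H H)
        (fst ℂ H H ∘L (eqv (H := H)).toContinuousLinearMap)
        (cfc (fun x : ℝ => (√(t ^ 2 + x))⁻¹) (G * star G)) +
      compSandwich ((eqv (H := H)).symm.toContinuousLinearMap ∘L inr ℂ H H)
        (snd ℂ H H ∘L (eqv (H := H)).toContinuousLinearMap)
        (cfc (fun x : ℝ => (√(t ^ 2 + x))⁻¹) (star G * G)) := by
  refine ContinuousLinearMap.ext fun x => prodL2_ext ?_ ?_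
  · rw [LamInv_fst, add_apply, compSandwich_apply, compSandwich_apply]
    exact (add_zero _).symm
  · rw [LamInv_snd, add_apply, compSandwich_apply, compSandwich_apply]
    exact (zero_add _).symm

theorem differentiableAt_compSandwich {E F : Type*} [NormedAddCommGroup E] [NormedSpace ℂ E]
    [NormedAddCommGroup F] [NormedSpace ℂ F] (J : E →L[ℂ] F) (P : F →L[ℂ] E)
    {a : ℝ → E →L[ℂ] E} {t : ℝ} (ha : DifferentiableAt ℝ a t) :
    DifferentiableAt ℝ (fun t => compSandwich J P (a t)) t :=
  ((compSandwich J P).hasFDerivAt.restrictScalars ℝ).differentiableAt.comp t ha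

theorem differentiableAt_LamInv {G : H →L[ℂ] H} (hG : IsUnit G) (t : ℝ) :
    DifferentiableAt ℝ (LamInv G) t := by
  rw [funext (LamInv_eq_compSandwich G)]
  exact (differentiableAt_compSandwich _ _ (hasDerivAt_cfc_inv_sqrt
      (IsSelfAdjoint.mul_star_self G) (spectrum_mul_star_pos hG) t).differentiableAt).add
    (differentiableAt_compSandwich _ _ (hasDerivAt_cfc_inv_sqrt
      (IsSelfAdjoint.star_mul_self G) (spectrum_star_mul_pos hG) t).differentiableAt)

theorem differentiable_F1 {E : Type*} [NormedAddCommGroup E]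
    [InnerProductSpace ℂ E] {f : ℝ × ℝ → ℝ} (hf : C2Bdd f) {u : ℝ → WithLp 2 (E × E)}
    (hu : Differentiable ℝ u) : Differentiable ℝ fun s => F1 f (u s) := by
  have hp : Differentiable ℝ fun s => eqv (u s) :=
    ((eqv (H := E)).toContinuousLinearMap.restrictScalars ℝ).differentiable.comp hu
  have h1 : Differentiable ℝ fun s => ‖(u s).fst‖ ^ 2 := hp.fst.norm_sq ℂ
  have h2 : Differentiable ℝ fun s => ‖(u s).snd‖ ^ 2 := hp.snd.norm_sq ℂ
  exact (hf.1.differentiable (by norm_num)).comp (h1.prodMk h2)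

theorem differentiable_F2 {E : Type*} [NormedAddCommGroup E]
    [InnerProductSpace ℂ E] {f : ℝ × ℝ → ℝ} (hf : C2Bdd f) {u : ℝ → WithLp 2 (E × E)}
    (hu : Differentiable ℝ u) : Differentiable ℝ fun s => F2 f (u s) :=
  differentiable_F1 hf hu

theorem IsLZSol.differentiable {G : H →L[ℂ] H} {δ : ℝ} {f₁ f₂ : ℝ × ℝ → ℝ}
    {u : ℝ → WithLp 2 (H × H)} (hu : IsLZSol G δ f₁ f₂ u) : Differentiable ℝ u :=
  fun s => (hu s).differentiableAt

theorem differentiable_sigma {E : Type*} [NormedAddCommGroup E]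
    [InnerProductSpace ℂ E] {δ : ℝ} {f₁ f₂ : ℝ × ℝ → ℝ} (hf₁ : C2Bdd f₁) (hf₂ : C2Bdd f₂)
    {u : ℝ → WithLp 2 (E × E)} (hu : Differentiable ℝ u) :
    Differentiable ℝ (sigma δ f₁ f₂ u) :=
  differentiable_id.add (((differentiable_F1 hf₁ hu).sub (differentiable_F2 hf₂ hu)).const_mul _)

/-- The gauge transform satisfies `v′(s) = i V(σ(s)) v(s)`. -/
theorem IsLZSol.hasDerivAt_gaugeT {G : H →L[ℂ] H} {δ : ℝ} {f₁ f₂ : ℝ × ℝ → ℝ}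
    (hf₁ : C2Bdd f₁) (hf₂ : C2Bdd f₂) {u : ℝ → WithLp 2 (H × H)}
    (hu : IsLZSol G δ f₁ f₂ u) (s : ℝ) :
    HasDerivAt (gaugeT δ f₁ f₂ u)
      (Complex.I • Vop G (sigma δ f₁ f₂ u s) (gaugeT δ f₁ f₂ u s)) s := by
  have hM : Continuous fun τ => Mscal δ f₁ f₂ (u τ) :=
    (((differentiable_F1 hf₁ hu.differentiable).add
      (differentiable_F2 hf₂ hu.differentiable)).const_mul _).continuous
  have hint := intervalIntegral.integral_hasDerivAt_right (hM.intervalIntegrable 0 s)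
    (hM.stronglyMeasurableAtFilter _ _) hM.continuousAt
  have h := ((hint.ofReal_comp.const_mul Complex.I).neg.cexp).smul (hu s)
  refine h.congr_deriv ?_
  simp only [gaugeT, map_smul]
  refine prodL2_ext ?_ ?_
  · simp [Vop_fst, nlt, sigma, mscal, Mscal]
    simp only [← Complex.coe_smul]
    module
  · simp [Vop_snd, nlt, sigma, mscal, Mscal]
    simp only [← Complex.coe_smul]
    module

theorem HasDerivAt.clm_apply_complex {E F : Type*} [NormedAddCommGroup E] [NormedSpace ℂ E]
    [NormedAddCommGroup F] [NormedSpace ℂ F] {B : ℝ → E →L[ℂ] F} {B' : E →L[ℂ] F}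
    {v : ℝ → E} {v' : E} {s : ℝ} (hB : HasDerivAt B B' s) (hv : HasDerivAt v v' s) :
    HasDerivAt (fun t => B t (v t)) (B' (v s) + B s v') s := by
  have h := ((isBoundedBilinearMap_apply (𝕜 := ℂ) (E := E) (F := F)).hasFDerivAt
    (B s, v s)).restrictScalars ℝ |>.comp_hasDerivAt s (hB.prodMk hv)
  exact h.congr_deriv (add_comm _ _)

/-- integration-by-parts identity for antidiagonal operators along the
flow (Lemma 3.8). -/
theorem stmt_12 (G : H →L[ℂ] H) (hG : CommHyp G) (hGu : IsUnit G) (δ : ℝ)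
    (f₁ f₂ : ℝ × ℝ → ℝ) (hf₁ : C2Bdd f₁) (hf₂ : C2Bdd f₂)
    (u : ℝ → WithLp 2 (H × H)) (hu : IsLZSol G δ f₁ f₂ u)
    (v : ℝ → WithLp 2 (H × H)) (hv : v = gaugeT δ f₁ f₂ u)
    (Cfun : ℝ → (WithLp 2 (H × H) →L[ℂ] WithLp 2 (H × H))) (hC : ContDiff ℝ 1 Cfun)
    (hcomm : ∀ s : ℝ, Cfun s ∘L LamOp G (sigma δ f₁ f₂ u s)
      = LamOp G (sigma δ f₁ f₂ u s) ∘L Cfun s)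
    (hoff : ∀ s : ℝ, Cfun s
      = PiP G (sigma δ f₁ f₂ u s) ∘L Cfun s ∘L PiM G (sigma δ f₁ f₂ u s)) :
    ∃ B' : ℝ → (WithLp 2 (H × H) →L[ℂ] WithLp 2 (H × H)),
      (∀ s : ℝ, HasDerivAt
        (fun t : ℝ => (2 : ℂ)⁻¹ • (LamInv G (sigma δ f₁ f₂ u t) ∘L Cfun t)) (B' s) s) ∧
      ∀ s : ℝ, ∃ dd : ℂ,
        HasDerivAt (fun t : ℝ =>
          (⟪((2 : ℂ)⁻¹ • (LamInv G (sigma δ f₁ f₂ u t) ∘L Cfun t)) (v t), v t⟫_ℂ)) dd s ∧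
        ⟪Cfun s (v s), v s⟫_ℂ
          = -Complex.I * dd + Complex.I * ⟪B' s (v s), v s⟫_ℂ := by
  subst hv
  have hσ := differentiable_sigma (δ := δ) hf₁ hf₂ hu.differentiable
  have hB : ∀ s, DifferentiableAt ℝ
      (fun t : ℝ => (2 : ℂ)⁻¹ • (LamInv G (sigma δ f₁ f₂ u t) ∘L Cfun t)) s := fun s => by
    have hL := (differentiableAt_LamInv hGu (sigma δ f₁ f₂ u s)).comp s (hσ s)
    have hCs := hC.differentiable (by norm_num) s
    exact (hL.mul hCs).const_smul (2 : ℂ)⁻¹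
  refine ⟨_, fun s => (hB s).hasDerivAt, fun s => ?_⟩
  have hv := hu.hasDerivAt_gaugeT hf₁ hf₂ s
  have hBv := (hB s).hasDerivAt.clm_apply_complex hv
  refine ⟨_, hBv.inner ℂ hv, ?_⟩
  have hcommutator := DFunLike.congr_fun (commutator_eq_of_offdiagonal
    (LamInv_mul_LamOp hGu _) (LamOp_mul_LamInv hGu _) (Vop_mul_LamOp hG _)
    (LamOp_mul_self hGu _) (hcomm s) (hoff s)) (gaugeT δ f₁ f₂ u s)
  have hinner := congrArg (fun w => ⟪w, gaugeT δ f₁ f₂ u s⟫_ℂ) hcommutator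
  simp only [sub_apply, mul_apply_eq_comp, inner_sub_left, Vop_symmetric] at hinner
  simp only [inner_add_left, map_smul, inner_smul_left, inner_smul_right, Complex.conj_I]
  linear_combination Complex.I ^ 2 * hinner
    + ⟪Cfun s (gaugeT δ f₁ f₂ u s), gaugeT δ f₁ f₂ u s⟫_ℂ * Complex.I_sq

end
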